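/- Fix ω > 0 and define Q̃₁(ξ) := −∫_ℝ [ φ_ω(x)(Φ₁(x)² + 2 Φ₁(x) Φ₂(x)) · conj(Ψ₁,ω(x,ξ)) + φ_ω(x)(Φ₂(x)² + 2 Φ₁(x) Φ₂(x)) · conj(Ψ₂,ω(x,ξ)) ] dx. Then for every ξ ∈ ℝ, Q̃₁(ξ) = (ω − ξ²) · (24 √π)^{−1} · ξ² (ω + ξ²) / ( ω² (|ξ| + i√ω)² ) · sech( (π/2) · ξ/√ω ). In particular Q̃₁(√ω) = Q̃₁(−√ω) = 0 (the null structure of the resonant quadratic coefficient). -/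

import Mathlib

open MeasureTheory

/-- `sech x = 1 / cosh x`. -/
noncomputable def sech (x : ℝ) : ℝ := 1 / Real.cosh x

/-- The ground state `φ_ω(x) = √(2ω) sech(√ω x)`. -/
noncomputable def phi (ω x : ℝ) : ℝ := Real.sqrt (2 * ω) * sech (Real.sqrt ω * x)

/-- `Ψ₁,ω(x,ξ) = (2π)^{−1/2} (ξ + i√ω tanh(√ω x))² (|ξ| − i√ω)^{−2} e^{ixξ}`. -/
noncomputable def Psi1 (ω x ξ : ℝ) : ℂ :=
  ((Real.sqrt (2 * Real.pi) : ℝ) : ℂ)⁻¹ *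
    ((ξ : ℂ) + Complex.I * ((Real.sqrt ω : ℝ) : ℂ) *
        ((Real.tanh (Real.sqrt ω * x) : ℝ) : ℂ)) ^ 2 /
      (((|ξ| : ℝ) : ℂ) - Complex.I * ((Real.sqrt ω : ℝ) : ℂ)) ^ 2 *
    Complex.exp (Complex.I * x * ξ)

/-- `Ψ₂,ω(x,ξ) = (2π)^{−1/2} ω sech²(√ω x) (|ξ| − i√ω)^{−2} e^{ixξ}`. -/
noncomputable def Psi2 (ω x ξ : ℝ) : ℂ :=
  ((Real.sqrt (2 * Real.pi) : ℝ) : ℂ)⁻¹ *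
    ((ω : ℂ) * ((sech (Real.sqrt ω * x) ^ 2 : ℝ) : ℂ)) /
      (((|ξ| : ℝ) : ℂ) - Complex.I * ((Real.sqrt ω : ℝ) : ℂ)) ^ 2 *
    Complex.exp (Complex.I * x * ξ)

/-- `Φ₁(x) = (2π)^{−1/2} tanh²(√ω x)`. -/
noncomputable def PhiOne (ω x : ℝ) : ℝ :=
  (Real.sqrt (2 * Real.pi))⁻¹ * Real.tanh (Real.sqrt ω * x) ^ 2

/-- `Φ₂(x) = −(2π)^{−1/2} sech²(√ω x)`. -/
noncomputable def PhiTwo (ω x : ℝ) : ℝ :=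
  -(Real.sqrt (2 * Real.pi))⁻¹ * sech (Real.sqrt ω * x) ^ 2

/-- The resonant quadratic coefficient
`Q̃₁(ξ) = −∫ [φ_ω(Φ₁² + 2Φ₁Φ₂) conj(Ψ₁,ω) + φ_ω(Φ₂² + 2Φ₁Φ₂) conj(Ψ₂,ω)] dx`. -/
noncomputable def Qtilde1 (ω ξ : ℝ) : ℂ :=
  -∫ x : ℝ,
    (((phi ω x * (PhiOne ω x ^ 2 + 2 * PhiOne ω x * PhiTwo ω x) : ℝ) : ℂ) *
        starRingEnd ℂ (Psi1 ω x ξ) +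
      ((phi ω x * (PhiTwo ω x ^ 2 + 2 * PhiOne ω x * PhiTwo ω x) : ℝ) : ℂ) *
        starRingEnd ℂ (Psi2 ω x ξ))

theorem sech_pos (x : ℝ) : 0 < sech x := one_div_pos.mpr (Real.cosh_pos x)

theorem continuous_sech : Continuous sech :=
  continuous_const.div Real.continuous_cosh fun x => (Real.cosh_pos x).ne'

theorem continuous_tanh_real : Continuous Real.tanh := by
  simp only [funext Real.tanh_eq_sinh_div_cosh]
  exact Real.continuous_sinh.div Real.continuous_cosh fun x => (Real.cosh_pos x).ne'

theorem sech_sq_eq (x : ℝ) : sech x ^ 2 = 1 - Real.tanh x ^ 2 := by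
  have h := (Real.cosh_pos x).ne'
  have := Real.cosh_sq x
  rw [sech, Real.tanh_eq_sinh_div_cosh]
  field_simp
  linarith

theorem hasDerivAt_sech (x : ℝ) : HasDerivAt sech (-(sech x * Real.tanh x)) x := by
  have h := (Real.cosh_pos x).ne'
  have := (hasDerivAt_const x (1 : ℝ)).div (Real.hasDerivAt_cosh x) h
  refine this.congr_deriv ?_
  rw [sech, Real.tanh_eq_sinh_div_cosh]
  field_simp
  ring

theorem hasDerivAt_tanh_real (x : ℝ) : HasDerivAt Real.tanh (1 - Real.tanh x ^ 2) x := by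
  have h := (Real.cosh_pos x).ne'
  have := (Real.hasDerivAt_sinh x).div (Real.hasDerivAt_cosh x) h
  rw [funext Real.tanh_eq_sinh_div_cosh]
  refine this.congr_deriv ?_
  field_simp

theorem sech_le (x : ℝ) : sech x ≤ 4 * (1 + x ^ 2)⁻¹ := by
  have h1 := Real.quadratic_le_exp_of_nonneg (abs_nonneg x)
  have h2 : Real.exp |x| ≤ 2 * Real.cosh x := by
    rw [← Real.cosh_abs, Real.cosh_eq]
    linarith [Real.exp_pos (-|x|)]
  rw [sq_abs] at h1
  rw [sech, ← div_eq_mul_inv, div_le_div_iff₀ (Real.cosh_pos x) (by positivity)]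
  nlinarith [abs_nonneg x, sq_nonneg x]

theorem integrable_sech : Integrable sech :=
  (integrable_inv_one_add_sq.const_mul 4).mono' continuous_sech.aestronglyMeasurable
    (.of_forall fun x => by rw [Real.norm_of_nonneg (sech_pos x).le]; exact sech_le x)

/-- `sech` beats any continuous function of `tanh` times an oscillating exponential. -/
theorem integrable_sech_mul_tanh_mul_exp (k : ℝ) {h : ℝ → ℂ} (hh : Continuous h) :
    Integrable fun y : ℝ =>
      (sech y : ℂ) * (h (Real.tanh y) * Complex.exp (-(Complex.I * k * y))) := by
  obtain ⟨C, hC⟩ := (isCompact_Icc (a := (-1 : ℝ)) (b := 1)).exists_bound_of_continuousOn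
    hh.continuousOn
  refine integrable_sech.ofReal.mul_bdd (c := C) ?_ (.of_forall fun y => ?_)
  · exact ((hh.comp continuous_tanh_real).mul (by fun_prop)).aestronglyMeasurable
  · have h1 : ‖Complex.exp (-(Complex.I * k * y))‖ = 1 := by
      rw [Complex.norm_exp]
      simp
    rw [norm_mul, h1, mul_one]
    exact hC _ ⟨(Real.neg_one_lt_tanh y).le, (Real.tanh_lt_one y).le⟩

/-- The Euler reflection integral `∫ σ(z)^u (1 - σ(z))^(1-u) dz = π / sin (π u)`, with `σ` the
logistic function, in exponential form. -/
theorem integral_one_sub_sigmoid_mul_exp {u : ℂ} (h0 : 0 < u.re) (h1 : u.re < 1) :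
    ∫ z : ℝ, ((1 - Real.sigmoid z : ℝ) : ℂ) * Complex.exp (u * z) =
      Real.pi / Complex.sin (Real.pi * u) := by
  have hB := Complex.betaIntegral_eq_Gamma_mul_div u (1 - u) h0 (by simpa using h1)
  rw [add_sub_cancel, Complex.Gamma_one, div_one, Complex.Gamma_mul_Gamma_one_sub] at hB
  rw [← hB, Complex.betaIntegral, intervalIntegral.integral_of_le zero_le_one,
    integral_Ioc_eq_integral_Ioo, ← Real.range_sigmoid, ← Set.image_univ,
    integral_image_eq_integral_abs_deriv_smul MeasurableSet.univ
      (fun x _ => (Real.hasDerivAt_sigmoid x).hasDerivWithinAt) Real.sigmoid_injective.injOn,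
    setIntegral_univ]
  congr 1 with z
  have hs := Real.sigmoid_pos z
  have hs' : 0 < 1 - Real.sigmoid z := sub_pos.mpr (Real.sigmoid_lt_one z)
  have hz : Real.log (Real.sigmoid z) - Real.log (1 - Real.sigmoid z) = z := by
    rw [← Real.sigmoid_neg, ← Real.sigmoid_mul_rexp_neg,
      Real.log_mul hs.ne' (Real.exp_pos _).ne', Real.log_exp]
    ring
  have hl : ((Real.log (1 - Real.sigmoid z) : ℝ) : ℂ) = Real.log (Real.sigmoid z) - z := by
    rw [← Complex.ofReal_sub]
    congr 1
    linarith
  have hsC : ((Real.sigmoid z : ℝ) : ℂ) ≠ 0 := by exact_mod_cast hs.ne'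
  have hsC' : ((1 - Real.sigmoid z : ℝ) : ℂ) ≠ 0 := by exact_mod_cast hs'.ne'
  rw [abs_of_pos (mul_pos hs hs'), Complex.real_smul, Complex.ofReal_mul,
    ← Complex.ofReal_one, ← Complex.ofReal_sub, Complex.cpow_def_of_ne_zero hsC,
    Complex.cpow_def_of_ne_zero hsC', ← Complex.ofReal_log hs.le, ← Complex.ofReal_log hs'.le, hl,
    ← Complex.exp_add]
  have he : ((Real.sigmoid z : ℝ) : ℂ) = Complex.exp (Real.log (Real.sigmoid z)) := by
    rw [← Complex.ofReal_exp, Real.exp_log hs]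
  rw [mul_comm ((Real.sigmoid z : ℝ) : ℂ), mul_assoc]
  rw [he]
  rw [← Complex.exp_add]
  congr 2
  push_cast
  ring

/-- The Fourier transform of `sech`. -/
theorem integral_sech_mul_exp (k : ℝ) :
    ∫ y : ℝ, (sech y : ℂ) * Complex.exp (-(Complex.I * k * y)) =
      Real.pi * (sech (Real.pi / 2 * k) : ℝ) := by
  have h := integral_one_sub_sigmoid_mul_exp (u := 1 / 2 - Complex.I * k / 2)
    (by simp) (by simp; norm_num)
  have hc := Measure.integral_comp_mul_left
    (fun z : ℝ => ((1 - Real.sigmoid z : ℝ) : ℂ) *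
      Complex.exp ((1 / 2 - Complex.I * k / 2) * z)) 2
  have hsin : Complex.sin (Real.pi * (1 / 2 - Complex.I * k / 2)) =
      (Real.cosh (Real.pi / 2 * k) : ℝ) := by
    rw [Complex.ofReal_cosh, ← Complex.cos_mul_I, ← Complex.sin_pi_div_two_sub]
    congr 1
    push_cast
    ring
  have hpt (y : ℝ) : (sech y : ℂ) * Complex.exp (-(Complex.I * k * y)) =
      2 * (((1 - Real.sigmoid (2 * y) : ℝ) : ℂ) *
        Complex.exp ((1 / 2 - Complex.I * k / 2) * ((2 * y : ℝ) : ℂ))) := by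
    have he : Complex.exp ((1 / 2 - Complex.I * k / 2) * ((2 * y : ℝ) : ℂ)) =
        (Real.exp y : ℝ) * Complex.exp (-(Complex.I * k * y)) := by
      rw [Complex.ofReal_exp, ← Complex.exp_add]
      congr 1
      push_cast
      ring
    have hs : sech y = 2 * ((1 - Real.sigmoid (2 * y)) * Real.exp y) := by
      rw [← Real.sigmoid_neg, Real.sigmoid_def, sech, Real.cosh_eq, neg_neg,
        show 2 * y = y + y by ring, Real.exp_add, Real.exp_neg]
      field
    rw [he, hs]
    push_cast
    ring
  simp only [hpt]
  rw [integral_const_mul, hc, h, hsin, sech]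
  rw [abs_of_pos (by norm_num), Complex.real_smul]
  push_cast
  field

/-- The profile of the integrand of `Qtilde1` in the rescaled variable, up to the factor
`sech y * exp (-i k y)`, as a polynomial in `t = tanh y`. -/
noncomputable def resonantProfile (k t : ℝ) : ℂ :=
  (t ^ 4 - 2 * t ^ 2 * (1 - t ^ 2)) * (k - Complex.I * t) ^ 2 +
    ((1 - t ^ 2) ^ 2 - 2 * t ^ 2 * (1 - t ^ 2)) * (1 - t ^ 2)

/-- A polynomial `p` such that `sech y * p (tanh y) * exp (-i k y)` is a primitive of the
integrand of `Qtilde1` modulo a multiple of `sech y * exp (-i k y)`. -/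
noncomputable def resonantPrimitive (k t : ℂ) : ℂ :=
  -Complex.I * k * (1 / 3 + k ^ 2 / 12 + k ^ 4 / 12) + (1 + 5 * k ^ 2 / 12 + k ^ 4 / 12) * t +
    Complex.I * k * (1 + k ^ 2 / 2) / 3 * t ^ 2 - (1 + k ^ 2 / 2) * t ^ 3 +
    Complex.I * k * t ^ 4 + t ^ 5

theorem hasDerivAt_resonantPrimitive (k t : ℂ) :
    HasDerivAt (resonantPrimitive k)
      ((1 + 5 * k ^ 2 / 12 + k ^ 4 / 12) + 2 * (Complex.I * k * (1 + k ^ 2 / 2) / 3) * t -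
        3 * (1 + k ^ 2 / 2) * t ^ 2 + 4 * (Complex.I * k) * t ^ 3 + 5 * t ^ 4) t := by
  have hp (n : ℕ) := hasDerivAt_pow n t
  have := ((((((hasDerivAt_id t).const_mul (1 + 5 * k ^ 2 / 12 + k ^ 4 / 12)).const_add
    (-Complex.I * k * (1 / 3 + k ^ 2 / 12 + k ^ 4 / 12))).add
    ((hp 2).const_mul (Complex.I * k * (1 + k ^ 2 / 2) / 3))).sub
    ((hp 3).const_mul (1 + k ^ 2 / 2))).add ((hp 4).const_mul (Complex.I * k))).add (hp 5)
  refine this.congr_deriv ?_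
  push_cast
  ring

theorem hasDerivAt_sech_mul_resonantPrimitive (k y : ℝ) :
    HasDerivAt (fun y : ℝ => (sech y : ℂ) *
        (resonantPrimitive k (Real.tanh y : ℝ) * Complex.exp (-(Complex.I * k * y))))
      ((sech y : ℂ) * ((resonantProfile k (Real.tanh y) + k ^ 2 * (1 - k ^ 4) / 12) *
        Complex.exp (-(Complex.I * k * y)))) y := by
  have hE : HasDerivAt (fun y : ℝ => Complex.exp (-(Complex.I * k * y)))
      (Complex.exp (-(Complex.I * k * y)) * -(Complex.I * k * 1)) y :=
    ((Complex.ofRealCLM.hasDerivAt (x := y)).const_mul (Complex.I * k)).neg.cexp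
  have hP := (hasDerivAt_resonantPrimitive k (Real.tanh y : ℝ)).comp y
    (hasDerivAt_tanh_real y).ofReal_comp
  refine ((hasDerivAt_sech y).ofReal_comp.mul (hP.mul hE)).congr_deriv ?_
  simp only [Function.comp_apply, Pi.mul_apply, resonantPrimitive, resonantProfile]
  push_cast
  generalize ((sech y : ℝ) : ℂ) = s
  generalize Complex.exp (-(Complex.I * k * y)) = e
  generalize Complex.tanh y = t
  have hI := Complex.I_sq
  ring_nf
  simp only [hI]
  ring

theorem integral_sech_mul_resonantProfile (k : ℝ) :
    ∫ y : ℝ, (sech y : ℂ) *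
        (resonantProfile k (Real.tanh y) * Complex.exp (-(Complex.I * k * y))) =
      -(k ^ 2 * (1 - k ^ 4) / 12) * (Real.pi * (sech (Real.pi / 2 * k) : ℝ)) := by
  have hprof : Continuous (resonantProfile k) := by unfold resonantProfile; fun_prop
  have hprim : Continuous fun t : ℝ => resonantPrimitive k t := by
    unfold resonantPrimitive; fun_prop
  have hderiv : Continuous fun t : ℝ => resonantProfile k t + k ^ 2 * (1 - k ^ 4) / 12 :=
    hprof.add continuous_const
  have hi := integrable_sech_mul_tanh_mul_exp k hderiv
  have hi' := integrable_sech_mul_tanh_mul_exp k hprim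
  have h0 := integral_eq_zero_of_hasDerivAt_of_integrable
    (hasDerivAt_sech_mul_resonantPrimitive k) hi hi'
  have hs := integrable_sech_mul_tanh_mul_exp k (h := fun _ => 1) continuous_const
  simp only [one_mul] at hs
  have hsplit (y : ℝ) : (sech y : ℂ) * ((resonantProfile k (Real.tanh y) +
        k ^ 2 * (1 - k ^ 4) / 12) * Complex.exp (-(Complex.I * k * y))) =
      (sech y : ℂ) * (resonantProfile k (Real.tanh y) * Complex.exp (-(Complex.I * k * y))) +
        k ^ 2 * (1 - k ^ 4) / 12 * ((sech y : ℂ) * Complex.exp (-(Complex.I * k * y))) := by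
    ring
  simp only [hsplit] at h0
  rw [integral_add (integrable_sech_mul_tanh_mul_exp k hprof) (hs.const_mul _),
    integral_const_mul, integral_sech_mul_exp] at h0
  linear_combination h0

/-- The integrand of `Qtilde1`, with `ω = a²` and `ξ = a k`, as a rescaled resonant profile. -/
theorem Qtilde1_integrand_eq {a : ℝ} (ha : 0 < a) (k x : ℝ) :
    ((phi (a ^ 2) x * (PhiOne (a ^ 2) x ^ 2 + 2 * PhiOne (a ^ 2) x * PhiTwo (a ^ 2) x) : ℝ) : ℂ) *
        starRingEnd ℂ (Psi1 (a ^ 2) x (a * k)) +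
      ((phi (a ^ 2) x * (PhiTwo (a ^ 2) x ^ 2 + 2 * PhiOne (a ^ 2) x * PhiTwo (a ^ 2) x) : ℝ) : ℂ) *
        starRingEnd ℂ (Psi2 (a ^ 2) x (a * k)) =
    ((a * Real.sqrt 2 * (Real.sqrt (2 * Real.pi))⁻¹ ^ 3 : ℝ) : ℂ) / ((|k| : ℝ) + Complex.I) ^ 2 *
      ((sech (a * x) : ℂ) * (resonantProfile k (Real.tanh (a * x)) *
        Complex.exp (-(Complex.I * k * ((a * x : ℝ) : ℂ))))) := by
  have hk : (((|k| : ℝ) : ℂ) + Complex.I) ≠ 0 := fun h => by simpa using congrArg Complex.im h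
  have haC : (a : ℂ) ≠ 0 := by exact_mod_cast ha.ne'
  have hphi : Real.sqrt (2 * a ^ 2) = a * Real.sqrt 2 := by
    rw [Real.sqrt_mul (by norm_num), Real.sqrt_sq ha.le, mul_comm]
  have hexp : -Complex.I * x * ((a * k : ℝ) : ℂ) = -(Complex.I * k * ((a * x : ℝ) : ℂ)) := by
    push_cast; ring
  simp only [phi, PhiOne, PhiTwo, Psi1, Psi2, resonantProfile, hphi, Real.sqrt_sq ha.le, abs_mul,
    abs_of_pos ha, sech_sq_eq, map_mul, map_div₀, map_pow, map_add, map_sub, map_inv₀,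
    ← Complex.exp_conj, Complex.conj_ofReal, Complex.conj_I]
  rw [hexp, show ((a * |k| : ℝ) : ℂ) - -Complex.I * a = a * ((|k| : ℝ) + Complex.I) by
    push_cast; ring]
  generalize Complex.exp (-(Complex.I * k * ((a * x : ℝ) : ℂ))) = e
  generalize Real.tanh (a * x) = t
  generalize sech (a * x) = s
  generalize (Real.sqrt (2 * Real.pi)) = c
  push_cast
  field

theorem Qtilde1_rescaled {a : ℝ} (ha : 0 < a) (k : ℝ) :
    Qtilde1 (a ^ 2) (a * k) =
      ((1 - k ^ 2 : ℝ) : ℂ) * (((24 * Real.sqrt Real.pi : ℝ) : ℂ))⁻¹ *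
        (((k ^ 2 * (1 + k ^ 2) : ℝ) : ℂ) / ((|k| : ℝ) + Complex.I) ^ 2) *
          ((sech (Real.pi / 2 * k) : ℝ) : ℂ) := by
  have hk : (((|k| : ℝ) : ℂ) + Complex.I) ≠ 0 := fun h => by simpa using congrArg Complex.im h
  have hc := Measure.integral_comp_mul_left
    (fun y : ℝ => (sech y : ℂ) * (resonantProfile k (Real.tanh y) *
        Complex.exp (-(Complex.I * k * y)))) a
  have hconst : Real.sqrt 2 * (Real.sqrt (2 * Real.pi))⁻¹ ^ 3 * Real.pi =
      2⁻¹ * (Real.sqrt Real.pi)⁻¹ := by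
    have h2 : Real.sqrt 2 ^ 2 = 2 := Real.sq_sqrt (by norm_num)
    have hp : Real.sqrt Real.pi ^ 2 = Real.pi := Real.sq_sqrt Real.pi_pos.le
    have h2' : Real.sqrt 2 ≠ 0 := by positivity
    have hp' : Real.sqrt Real.pi ≠ 0 := (Real.sqrt_pos.mpr Real.pi_pos).ne'
    rw [Real.sqrt_mul (by norm_num)]
    field_simp
    linear_combination -Real.sqrt Real.pi ^ 2 * h2 - 2 * hp
  have hconstC := congrArg (fun r : ℝ => (r : ℂ)) hconst
  simp only [Qtilde1, Qtilde1_integrand_eq ha]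
  rw [integral_const_mul, hc, integral_sech_mul_resonantProfile, abs_of_pos (inv_pos.mpr ha),
    Complex.real_smul]
  have haC : (a : ℂ) ≠ 0 := by exact_mod_cast ha.ne'
  push_cast at hconstC ⊢
  rw [mul_inv, show ((Real.sqrt Real.pi : ℝ) : ℂ)⁻¹ = 2 * (Real.sqrt 2 *
    ((Real.sqrt (2 * Real.pi) : ℝ) : ℂ)⁻¹ ^ 3 * Real.pi) by rw [hconstC]; ring]
  generalize ((Real.sqrt (2 * Real.pi) : ℝ) : ℂ)⁻¹ = c
  field

/-- Null structure of the resonant quadratic coefficient: for every `ξ ∈ ℝ`,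
`Q̃₁(ξ) = (ω − ξ²) (24√π)^{−1} ξ²(ω + ξ²) / (ω²(|ξ| + i√ω)²) sech((π/2) ξ/√ω)`;
in particular `Q̃₁(±√ω) = 0`. -/
theorem null_structure_Qtilde1 (ω : ℝ) (hω : 0 < ω) :
    (∀ ξ : ℝ,
      Qtilde1 ω ξ =
        ((ω - ξ ^ 2 : ℝ) : ℂ) * (((24 * Real.sqrt Real.pi : ℝ) : ℂ))⁻¹ *
          (((ξ ^ 2 * (ω + ξ ^ 2) : ℝ) : ℂ) /
            (((ω ^ 2 : ℝ) : ℂ) *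
              (((|ξ| : ℝ) : ℂ) + Complex.I * ((Real.sqrt ω : ℝ) : ℂ)) ^ 2)) *
          ((sech (Real.pi / 2 * (ξ / Real.sqrt ω)) : ℝ) : ℂ)) ∧
    Qtilde1 ω (Real.sqrt ω) = 0 ∧ Qtilde1 ω (-Real.sqrt ω) = 0 := by
  have hs : 0 < Real.sqrt ω := Real.sqrt_pos.mpr hω
  have hω' : Real.sqrt ω ^ 2 = ω := Real.sq_sqrt hω.le
  refine ⟨fun ξ => ?_, ?_, ?_⟩
  · have h := Qtilde1_rescaled hs (ξ / Real.sqrt ω)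
    rw [hω', mul_div_cancel₀ ξ hs.ne'] at h
    rw [h, abs_div, abs_of_pos hs]
    have hsC : ((Real.sqrt ω : ℝ) : ℂ) ≠ 0 := by exact_mod_cast hs.ne'
    have hd : ((|ξ| : ℝ) : ℂ) + Complex.I * ((Real.sqrt ω : ℝ) : ℂ) ≠ 0 := fun h =>
      hs.ne' (by simpa using congrArg Complex.im h)
    have hd' : ((|ξ| / Real.sqrt ω : ℝ) : ℂ) + Complex.I =
        (((|ξ| : ℝ) : ℂ) + Complex.I * ((Real.sqrt ω : ℝ) : ℂ)) / (Real.sqrt ω : ℝ) := by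
      push_cast
      field
    have hωC : (ω : ℂ) = ((Real.sqrt ω : ℝ) : ℂ) ^ 2 := by exact_mod_cast hω'.symm
    rw [hd']
    push_cast
    rw [hωC]
    field
  · simpa [hω'] using Qtilde1_rescaled hs 1
  · simpa [hω'] using Qtilde1_rescaled hs (-1)
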